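/- arXiv:2102.10327 — 2 statements merged into one kernel-verified Lean document; each statement's English description precedes it below -/
import Mathlib

section
/- Let A : ℝ^{N×N}, L : ℝ^{N×N}, b ∈ ℝ^N, μ > 0, ρ > 0. Suppose the unaugmented Lagrangian L₀ admits a saddle point, and let sequences (x^k), (z^k), (y^k), (w^k) in ℝ^N and (λ^k) in ℝ^{3N} satisfy the ADMM iteration: (x^{k+1}, z^{k+1}) minimizes (x,z) ↦ L_ρ(x,z,y^k,w^k;λ^k); (y^{k+1}, w^{k+1}) minimizes (y,w) ↦ L_ρ(x^{k+1},z^{k+1},y,w;λ^k); λ^{k+1} = λ^k + ρ·r(x^{k+1},z^{k+1},y^{k+1},w^{k+1}). Then the multiplier sequence (λ^k) converges to a dual optimal point λ^∞, i.e. λ^∞ maximizes the dual function d(λ) = inf_{x,z,y,w} L₀(x,z,y,w;λ) over λ ∈ ℝ^{3N}. -/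
open Filter Topology

/-- Squared Euclidean norm of a vector in `ℝ^N`. -/
noncomputable def sqnorm {N : ℕ} (v : Fin N → ℝ) : ℝ := ∑ i, (v i) ^ 2

/-- The `ℓ¹` norm of a vector in `ℝ^N`. -/
noncomputable def l1norm {N : ℕ} (v : Fin N → ℝ) : ℝ := ∑ i, |v i|

/-- Euclidean inner product on `ℝ^N`. -/
noncomputable def ip {N : ℕ} (u v : Fin N → ℝ) : ℝ := ∑ i, u i * v i

/-- Euclidean inner product on `ℝ^{3N}` viewed as a triple of vectors. -/
noncomputable def ip3 {N : ℕ} (u v : (Fin N → ℝ) × (Fin N → ℝ) × (Fin N → ℝ)) : ℝ :=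
  ip u.1 v.1 + ip u.2.1 v.2.1 + ip u.2.2 v.2.2

/-- Squared Euclidean norm on `ℝ^{3N}` viewed as a triple of vectors. -/
noncomputable def sqnorm3 {N : ℕ} (u : (Fin N → ℝ) × (Fin N → ℝ) × (Fin N → ℝ)) : ℝ :=
  sqnorm u.1 + sqnorm u.2.1 + sqnorm u.2.2

open Classical in
/-- Indicator function `ι₀` of the nonnegative orthant, with values in the extended reals. -/
noncomputable def iota0 {N : ℕ} (w : Fin N → ℝ) : EReal := if 0 ≤ w then 0 else ⊤

/-- Constraint residual `r(x,z,y,w) = (x − y, z − Ly, x − w) ∈ ℝ^{3N}`. -/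
noncomputable def resid {N : ℕ} (L : Matrix (Fin N) (Fin N) ℝ) (x z y w : Fin N → ℝ) :
    (Fin N → ℝ) × (Fin N → ℝ) × (Fin N → ℝ) :=
  (x - y, z - L.mulVec y, x - w)

/-- The unaugmented Lagrangian
`L₀(x,z,y,w;λ) = (1/2)‖Ax − b‖² + μ‖z‖₁ + ι₀(w) + ⟨λ, r(x,z,y,w)⟩`. -/
noncomputable def lag0 {N : ℕ} (A L : Matrix (Fin N) (Fin N) ℝ) (b : Fin N → ℝ) (μ : ℝ)
    (x z y w : Fin N → ℝ) (lam : (Fin N → ℝ) × (Fin N → ℝ) × (Fin N → ℝ)) : EReal :=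
  ((1 / 2 * sqnorm (A.mulVec x - b) + μ * l1norm z + ip3 lam (resid L x z y w) : ℝ) : EReal)
    + iota0 w

/-- The augmented Lagrangian `L_ρ = L₀ + (ρ/2)‖r(x,z,y,w)‖²`. -/
noncomputable def lagAug {N : ℕ} (A L : Matrix (Fin N) (Fin N) ℝ) (b : Fin N → ℝ) (μ ρ : ℝ)
    (x z y w : Fin N → ℝ) (lam : (Fin N → ℝ) × (Fin N → ℝ) × (Fin N → ℝ)) : EReal :=
  lag0 A L b μ x z y w lam + ((ρ / 2 * sqnorm3 (resid L x z y w) : ℝ) : EReal)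

/-- The dual function `d(λ) = inf_{x,z,y,w} L₀(x,z,y,w;λ)`. -/
noncomputable def dualFn {N : ℕ} (A L : Matrix (Fin N) (Fin N) ℝ) (b : Fin N → ℝ) (μ : ℝ)
    (lam : (Fin N → ℝ) × (Fin N → ℝ) × (Fin N → ℝ)) : EReal :=
  ⨅ (x : Fin N → ℝ) (z : Fin N → ℝ) (y : Fin N → ℝ) (w : Fin N → ℝ), lag0 A L b μ x z y w lam

/-- First-order optimality: a minimizer over a convex set of a convex function plus a quadratic
penalty satisfies the corresponding variational inequality. -/
theorem ConvexOn.variational_of_forall_le {E G : Type*} [AddCommGroup E] [Module ℝ E]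
    [NormedAddCommGroup G] [InnerProductSpace ℝ G] {C : Set E} {f : E → ℝ} (hf : ConvexOn ℝ C f)
    (T : E →ₗ[ℝ] G) (c l : G) (ρ : ℝ) {u₀ : E} (hu₀ : u₀ ∈ C)
    (hmin : ∀ u ∈ C, f u₀ + inner ℝ l (T u₀ - c) + ρ / 2 * ‖T u₀ - c‖ ^ 2 ≤
      f u + inner ℝ l (T u - c) + ρ / 2 * ‖T u - c‖ ^ 2) {u : E} (hu : u ∈ C) :
    f u₀ ≤ f u + inner ℝ (l + ρ • (T u₀ - c)) (T u - T u₀) := by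
  have key : ∀ t ∈ Set.Ioo (0 : ℝ) 1,
      f u₀ ≤ f u + inner ℝ (l + ρ • (T u₀ - c)) (T u - T u₀) +
        t * (ρ / 2 * ‖T u - T u₀‖ ^ 2) := by
    rintro t ⟨ht0, ht1⟩
    have hmem := hf.1 hu₀ hu (sub_nonneg.2 ht1.le) ht0.le (by ring)
    have hconv := hf.2 hu₀ hu (sub_nonneg.2 ht1.le) ht0.le (by ring)
    have h := hmin _ hmem
    have hT : T ((1 - t) • u₀ + t • u) - c = (T u₀ - c) + t • (T u - T u₀) := by
      simp only [map_add, map_smul]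
      module
    rw [hT, norm_add_sq_real, inner_add_right, inner_smul_right, inner_smul_right, norm_smul,
      mul_pow, Real.norm_eq_abs, sq_abs] at h
    simp only [smul_eq_mul] at hconv
    rw [inner_add_left, real_inner_smul_left]
    have : 0 ≤ t * (f u + (inner ℝ l (T u - T u₀) + ρ * inner ℝ (T u₀ - c) (T u - T u₀)) +
        t * (ρ / 2 * ‖T u - T u₀‖ ^ 2) - f u₀) := by nlinarith
    linarith [nonneg_of_mul_nonneg_right this ht0]
  have hlim : Tendsto (fun t : ℝ => f u + inner ℝ (l + ρ • (T u₀ - c)) (T u - T u₀) +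
      t * (ρ / 2 * ‖T u - T u₀‖ ^ 2)) (𝓝[>] 0)
      (𝓝 (f u + inner ℝ (l + ρ • (T u₀ - c)) (T u - T u₀) +
        0 * (ρ / 2 * ‖T u - T u₀‖ ^ 2))) := by
    apply Tendsto.mono_left _ nhdsWithin_le_nhds
    apply Continuous.tendsto
    fun_prop
  rw [zero_mul, add_zero] at hlim
  exact ge_of_tendsto hlim (by
    filter_upwards [Ioo_mem_nhdsGT (zero_lt_one (α := ℝ))] with t ht using key t ht)

section ADMM

variable {E F G : Type*} [NormedAddCommGroup E] [NormedSpace ℝ E]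
  [NormedAddCommGroup F] [NormedSpace ℝ F]
  [NormedAddCommGroup G] [InnerProductSpace ℝ G]

/-- Optimality conditions for minimizing `f u` subject to `P u = Q v` and `v ∈ C`, with
multiplier `l`. -/
structure IsKKT (f : E → ℝ) (C : Set F) (P : E →ₗ[ℝ] G) (Q : F →ₗ[ℝ] G)
    (u : E) (v : F) (l : G) : Prop where
  feas : P u = Q v
  mem : v ∈ C
  primal : ∀ u', f u ≤ f u' + inner ℝ l (P u' - P u)
  normal : ∀ v' ∈ C, inner ℝ l (Q v' - Q v) ≤ 0

/-- Optimality conditions satisfied by the ADMM iterates for minimizing `f u` subject to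
`P u = Q v` and `v ∈ C`. -/
structure IsADMM (f : E → ℝ) (C : Set F) (P : E →ₗ[ℝ] G) (Q : F →ₗ[ℝ] G) (ρ : ℝ)
    (u : ℕ → E) (v : ℕ → F) (l : ℕ → G) : Prop where
  mem : ∀ k, v k ∈ C
  normal : ∀ k, ∀ v' ∈ C, inner ℝ (l k) (Q v' - Q (v k)) ≤ 0
  primal : ∀ k u', f (u (k + 1)) ≤
    f u' + inner ℝ (l k + ρ • (P (u (k + 1)) - Q (v k))) (P u' - P (u (k + 1)))
  update : ∀ k, l (k + 1) = l k + ρ • (P (u (k + 1)) - Q (v (k + 1)))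

/-- The Lyapunov function of ADMM. -/
noncomputable def admmLyapunov (Q : F →ₗ[ℝ] G) (ρ : ℝ) (v₀ : F) (l₀ : G) (v : F) (l : G) : ℝ :=
  ‖l - l₀‖ ^ 2 + ρ ^ 2 * ‖Q v - Q v₀‖ ^ 2

variable {f : E → ℝ} {C : Set F} {P : E →ₗ[ℝ] G} {Q : F →ₗ[ℝ] G} {ρ : ℝ}
  {u : ℕ → E} {v : ℕ → F} {l : ℕ → G} {u₀ : E} {v₀ : F} {l₀ : G}

theorem IsADMM.lyapunov_succ_add_le (h : IsADMM f C P Q ρ u v l) (h₀ : IsKKT f C P Q u₀ v₀ l₀)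
    (hρ : 0 < ρ) (k : ℕ) :
    admmLyapunov Q ρ v₀ l₀ (v (k + 1)) (l (k + 1)) +
      (‖l (k + 1) - l k‖ ^ 2 + ρ ^ 2 * ‖Q (v (k + 1)) - Q (v k)‖ ^ 2) ≤
      admmLyapunov Q ρ v₀ l₀ (v k) (l k) := by
  have h1 := h.primal k u₀
  have h2 := h₀.primal (u (k + 1))
  have h3 := h.normal (k + 1) v₀ h₀.mem
  have h4 := h₀.normal (v (k + 1)) (h.mem _)
  have h5 := h.normal (k + 1) (v k) (h.mem _)
  have h6 := h.normal k (v (k + 1)) (h.mem _)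
  rw [h₀.feas] at h1 h2
  unfold admmLyapunov
  obtain ⟨d, hd⟩ : ∃ d, d = P (u (k + 1)) - Q (v (k + 1)) := ⟨_, rfl⟩
  obtain ⟨e, he⟩ : ∃ e, e = Q (v (k + 1)) - Q (v k) := ⟨_, rfl⟩
  obtain ⟨s, hs⟩ : ∃ s, s = Q (v (k + 1)) - Q v₀ := ⟨_, rfl⟩
  obtain ⟨m, hm⟩ : ∃ m, m = l (k + 1) - l₀ := ⟨_, rfl⟩
  have hl : l (k + 1) = l k + ρ • d := by rw [hd]; exact h.update k
  have e1 : l k + ρ • (P (u (k + 1)) - Q (v k)) = l₀ + m + ρ • e := by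
    rw [hm, hl, hd, he]; module
  have e2 : Q v₀ - P (u (k + 1)) = -(d + s) := by rw [hd, hs]; abel
  have e3 : P (u (k + 1)) - Q v₀ = d + s := by rw [hd, hs]; abel
  have e4 : Q v₀ - Q (v (k + 1)) = -s := by rw [hs]; abel
  have e5 : Q (v k) - Q (v (k + 1)) = -e := by rw [he]; abel
  have e6 : Q (v k) - Q v₀ = s - e := by rw [he, hs]; abel
  have e7 : l (k + 1) = l₀ + m := by rw [hm]; abel
  have e8 : l k = l₀ + m - ρ • d := by rw [← e7, hl]; abel
  have e9 : l k - l₀ = m - ρ • d := by rw [e8]; abel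
  have e10 : l (k + 1) - l k = ρ • d := by rw [hl]; abel
  rw [e1, e2] at h1
  rw [e3] at h2
  rw [e4, e7] at h3
  rw [← hs] at h4
  rw [e5, e7] at h5
  rw [← he, e8] at h6
  rw [e10, e9, e6, ← hm, ← hs, ← he, norm_sub_sq_real, norm_sub_sq_real, norm_smul, mul_pow,
    Real.norm_eq_abs, sq_abs, real_inner_smul_right]
  simp only [inner_add_left, inner_sub_left, inner_neg_right, inner_add_right,
    real_inner_smul_left] at h1 h2 h3 h4 h5 h6
  rw [real_inner_comm e s]
  have hde : 0 ≤ inner ℝ d e := by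
    refine nonneg_of_mul_nonneg_right (a := ρ) ?_ hρ
    linarith
  rw [real_inner_comm d e] at h1
  have hmain : inner ℝ m d + ρ * inner ℝ e s ≤ 0 := by
    nlinarith
  nlinarith

theorem IsADMM.antitone_lyapunov (h : IsADMM f C P Q ρ u v l) (h₀ : IsKKT f C P Q u₀ v₀ l₀)
    (hρ : 0 < ρ) : Antitone fun k => admmLyapunov Q ρ v₀ l₀ (v k) (l k) := by
  refine antitone_nat_of_succ_le fun k => ?_
  have := h.lyapunov_succ_add_le h₀ hρ k
  have : 0 ≤ ‖l (k + 1) - l k‖ ^ 2 + ρ ^ 2 * ‖Q (v (k + 1)) - Q (v k)‖ ^ 2 := by positivity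
  linarith

theorem admmLyapunov_nonneg (v : F) (l : G) : 0 ≤ admmLyapunov Q ρ v₀ l₀ v l := by
  unfold admmLyapunov
  positivity

theorem IsADMM.tendsto_sub (h : IsADMM f C P Q ρ u v l) (h₀ : IsKKT f C P Q u₀ v₀ l₀)
    (hρ : 0 < ρ) :
    Tendsto (fun k => l (k + 1) - l k) atTop (𝓝 0) ∧
      Tendsto (fun k => Q (v (k + 1)) - Q (v k)) atTop (𝓝 0) := by
  have hlim := tendsto_atTop_ciInf (h.antitone_lyapunov h₀ hρ)
    ⟨0, by rintro _ ⟨k, rfl⟩; exact admmLyapunov_nonneg _ _⟩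
  have hdiff := hlim.sub (hlim.comp (tendsto_add_atTop_nat 1))
  rw [sub_self] at hdiff
  have hsq (x : ℕ → G) (c : ℝ) (hc : 0 < c) (hx : ∀ k, c ^ 2 * ‖x k‖ ^ 2 ≤
      admmLyapunov Q ρ v₀ l₀ (v k) (l k) - admmLyapunov Q ρ v₀ l₀ (v (k + 1)) (l (k + 1))) :
      Tendsto x atTop (𝓝 0) := by
    have h1 := squeeze_zero (fun k => by positivity) hx hdiff
    have h2 := (h1.sqrt).const_mul c⁻¹
    rw [Real.sqrt_zero, mul_zero] at h2
    rw [tendsto_zero_iff_norm_tendsto_zero]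
    refine h2.congr fun k => ?_
    rw [← mul_pow, Real.sqrt_sq (by positivity)]
    field_simp
  refine ⟨hsq _ 1 one_pos fun k => ?_, hsq _ ρ hρ fun k => ?_⟩
  · have := h.lyapunov_succ_add_le h₀ hρ k
    have : 0 ≤ ρ ^ 2 * ‖Q (v (k + 1)) - Q (v k)‖ ^ 2 := by positivity
    linarith
  · have := h.lyapunov_succ_add_le h₀ hρ k
    have : 0 ≤ ‖l (k + 1) - l k‖ ^ 2 := by positivity
    linarith

variable [FiniteDimensional ℝ E] [FiniteDimensional ℝ F] [FiniteDimensional ℝ G]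

theorem IsADMM.exists_subseq_tendsto (h : IsADMM f C P Q ρ u v l) (h₀ : IsKKT f C P Q u₀ v₀ l₀)
    (hρ : 0 < ρ) (hP : Function.Injective P) (hQ : Function.Injective Q) :
    ∃ u' v' l', ∃ φ : ℕ → ℕ, StrictMono φ ∧ Tendsto (fun k => u (φ k + 1)) atTop (𝓝 u') ∧
      Tendsto (fun k => v (φ k + 1)) atTop (𝓝 v') ∧
      Tendsto (fun k => l (φ k + 1)) atTop (𝓝 l') := by
  set V := admmLyapunov Q ρ v₀ l₀ (v 0) (l 0) with hV
  have hle k : admmLyapunov Q ρ v₀ l₀ (v k) (l k) ≤ V := h.antitone_lyapunov h₀ hρ (Nat.zero_le k)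
  have hl k : ‖l k - l₀‖ ≤ √V := by
    refine Real.le_sqrt_of_sq_le ((le_add_of_nonneg_right ?_).trans (hle k))
    positivity
  have hv k : ‖Q (v k) - Q v₀‖ ≤ ρ⁻¹ * √V := by
    rw [← div_eq_inv_mul, le_div_iff₀' hρ]
    refine Real.le_sqrt_of_sq_le (le_trans ?_ (hle k))
    rw [mul_pow]
    exact le_add_of_nonneg_left (by positivity)
  have hu k : ‖P (u (k + 1)) - Q v₀‖ ≤ ρ⁻¹ * (√V + √V) + ρ⁻¹ * √V := by
    have e : P (u (k + 1)) - Q v₀ =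
        ρ⁻¹ • ((l (k + 1) - l₀) - (l k - l₀)) + (Q (v (k + 1)) - Q v₀) := by
      rw [h.update k, add_sub_right_comm, add_sub_cancel_left, smul_smul, inv_mul_cancel₀ hρ.ne']
      module
    rw [e]
    refine (norm_add_le _ _).trans (add_le_add ?_ (hv _))
    rw [norm_smul, Real.norm_of_nonneg (by positivity)]
    gcongr
    exact (norm_sub_le _ _).trans (add_le_add (hl _) (hl _))
  have cP := (LinearMap.isClosedEmbedding_of_injective (LinearMap.ker_eq_bot.2 hP)
    ).isCompact_preimage (isCompact_closedBall (Q v₀) (ρ⁻¹ * (√V + √V) + ρ⁻¹ * √V))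
  have cQ := (LinearMap.isClosedEmbedding_of_injective (LinearMap.ker_eq_bot.2 hQ)
    ).isCompact_preimage (isCompact_closedBall (Q v₀) (ρ⁻¹ * √V))
  have cG := isCompact_closedBall l₀ (√V)
  obtain ⟨⟨u', v', l'⟩, -, φ, hφ, hlim⟩ := (cP.prod (cQ.prod cG)).tendsto_subseq
    (x := fun k => (u (k + 1), v (k + 1), l (k + 1)))
    fun k => ⟨mem_closedBall_iff_norm.2 (hu k), mem_closedBall_iff_norm.2 (hv _),
      mem_closedBall_iff_norm.2 (hl _)⟩
  exact ⟨u', v', l', φ, hφ, hlim.fst_nhds, hlim.snd_nhds.fst_nhds, hlim.snd_nhds.snd_nhds⟩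

/-- The multipliers of ADMM converge to the multiplier of a solution of the optimality
conditions. -/
theorem IsADMM.exists_tendsto_isKKT (h : IsADMM f C P Q ρ u v l) (h₀ : IsKKT f C P Q u₀ v₀ l₀)
    (hρ : 0 < ρ) (hP : Function.Injective P) (hQ : Function.Injective Q) (hf : Continuous f)
    (hC : IsClosed C) :
    ∃ u' v' l', Tendsto l atTop (𝓝 l') ∧ IsKKT f C P Q u' v' l' := by
  obtain ⟨u', v', l', φ, hφ, hu, hv, hl⟩ := h.exists_subseq_tendsto h₀ hρ hP hQ
  obtain ⟨hdl, hdv⟩ := h.tendsto_sub h₀ hρ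
  have cP := P.continuous_of_finiteDimensional
  have cQ := Q.continuous_of_finiteDimensional
  have hPu := (cP.tendsto u').comp hu
  have hQv := (cQ.tendsto v').comp hv
  have hfu := (hf.tendsto u').comp hu
  have hdl' := hdl.comp hφ.tendsto_atTop
  have hdv' := hdv.comp hφ.tendsto_atTop
  have hK : IsKKT f C P Q u' v' l' := by
    refine ⟨?_, hC.mem_of_tendsto hv (Eventually.of_forall fun k => h.mem _), fun x => ?_,
      fun y hy => ?_⟩
    · rw [← sub_eq_zero]
      refine tendsto_nhds_unique (hPu.sub hQv) ?_
      have := hdl'.const_smul ρ⁻¹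
      rw [smul_zero] at this
      refine this.congr fun k => ?_
      simp only [Function.comp_apply]
      rw [h.update, add_sub_cancel_left, smul_smul, inv_mul_cancel₀ hρ.ne', one_smul]
    · have hr : Tendsto (fun k => f x + inner ℝ (l (φ k + 1) + ρ • (Q (v (φ k + 1)) - Q (v (φ k))))
          (P x - P (u (φ k + 1)))) atTop (𝓝 (f x + inner ℝ (l' + ρ • (0 : G)) (P x - P u'))) :=
        tendsto_const_nhds.add
          ((hl.add (hdv'.const_smul ρ)).inner (tendsto_const_nhds.sub hPu))
      rw [smul_zero, add_zero] at hr
      refine le_of_tendsto_of_tendsto' hfu hr fun k => ?_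
      have e : l (φ k) + ρ • (P (u (φ k + 1)) - Q (v (φ k))) =
          l (φ k + 1) + ρ • (Q (v (φ k + 1)) - Q (v (φ k))) := by
        rw [h.update]
        module
      exact e ▸ h.primal (φ k) x
    · exact le_of_tendsto' (hl.inner (tendsto_const_nhds.sub hQv)) fun k => h.normal _ y hy
  refine ⟨u', v', l', ?_, hK⟩
  have hVsub : Tendsto (fun k => admmLyapunov Q ρ v' l' (v (φ k + 1)) (l (φ k + 1))) atTop
      (𝓝 (‖l' - l'‖ ^ 2 + ρ ^ 2 * ‖Q v' - Q v'‖ ^ 2)) :=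
    ((hl.sub_const l').norm.pow 2).add (((hQv.sub_const (Q v')).norm.pow 2).const_mul _)
  simp only [sub_self, norm_zero, ne_eq, OfNat.ofNat_ne_zero, not_false_eq_true, zero_pow,
    mul_zero, add_zero] at hVsub
  have hanti := h.antitone_lyapunov hK hρ
  have hV := tendsto_atTop_ciInf hanti ⟨0, by rintro _ ⟨k, rfl⟩; exact admmLyapunov_nonneg _ _⟩
  have hV0 := tendsto_nhds_unique
    (hV.comp ((tendsto_add_atTop_nat 1).comp hφ.tendsto_atTop)) hVsub
  rw [hV0] at hV
  have h2 := hV.sqrt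
  rw [Real.sqrt_zero] at h2
  rw [tendsto_iff_norm_sub_tendsto_zero]
  refine squeeze_zero (fun k => norm_nonneg _) (fun k => ?_) h2
  refine Real.le_sqrt_of_sq_le (le_add_of_nonneg_right ?_)
  positivity

end ADMM

section Coordinates

variable {N : ℕ}

/-- The identification of `ℝ^N × ℝ^N × ℝ^N` with a Euclidean space. -/
noncomputable def tripleEquiv (N : ℕ) : ((Fin N → ℝ) × (Fin N → ℝ) × (Fin N → ℝ)) ≃L[ℝ]
    EuclideanSpace ℝ (Fin N ⊕ Fin N ⊕ Fin N) :=
  LinearEquiv.toContinuousLinearEquiv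
    (((LinearEquiv.refl ℝ (Fin N → ℝ)).prodCongr
      (LinearEquiv.sumArrowLequivProdArrow (Fin N) (Fin N) ℝ ℝ).symm).trans
    ((LinearEquiv.sumArrowLequivProdArrow (Fin N) (Fin N ⊕ Fin N) ℝ ℝ).symm.trans
      (WithLp.linearEquiv 2 ℝ (Fin N ⊕ Fin N ⊕ Fin N → ℝ)).symm))

theorem inner_tripleEquiv (a b : (Fin N → ℝ) × (Fin N → ℝ) × (Fin N → ℝ)) :
    inner ℝ (tripleEquiv N a) (tripleEquiv N b) = ip3 a b := by
  simp [tripleEquiv, ip3, ip, PiLp.inner_apply, LinearEquiv.sumArrowLequivProdArrow,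
    Equiv.sumArrowEquivProdArrow, mul_comm, add_assoc]

theorem norm_sq_tripleEquiv (a : (Fin N → ℝ) × (Fin N → ℝ) × (Fin N → ℝ)) :
    ‖tripleEquiv N a‖ ^ 2 = sqnorm3 a := by
  rw [← real_inner_self_eq_norm_sq, inner_tripleEquiv]
  simp [ip3, ip, sqnorm3, sqnorm, sq]

/-- The map `(x, z) ↦ (x, z, x)`. -/
noncomputable def primalMap (N : ℕ) : ((Fin N → ℝ) × (Fin N → ℝ)) →ₗ[ℝ]
    EuclideanSpace ℝ (Fin N ⊕ Fin N ⊕ Fin N) :=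
  (tripleEquiv N).toLinearMap ∘ₗ
    (LinearMap.fst ℝ _ _).prod ((LinearMap.snd ℝ _ _).prod (LinearMap.fst ℝ _ _))

/-- The map `(y, w) ↦ (y, L y, w)`. -/
noncomputable def splitMap (L : Matrix (Fin N) (Fin N) ℝ) : ((Fin N → ℝ) × (Fin N → ℝ)) →ₗ[ℝ]
    EuclideanSpace ℝ (Fin N ⊕ Fin N ⊕ Fin N) :=
  (tripleEquiv N).toLinearMap ∘ₗ
    (LinearMap.fst ℝ _ _).prod ((L.mulVecLin ∘ₗ LinearMap.fst ℝ _ _).prod (LinearMap.snd ℝ _ _))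

theorem primalMap_injective : Function.Injective (primalMap N) := by
  rintro ⟨x, z⟩ ⟨x', z'⟩ h
  have := (tripleEquiv N).injective h
  simp_all

theorem splitMap_injective (L : Matrix (Fin N) (Fin N) ℝ) : Function.Injective (splitMap L) := by
  rintro ⟨y, w⟩ ⟨y', w'⟩ h
  have := (tripleEquiv N).injective h
  simp_all

theorem tripleEquiv_resid (L : Matrix (Fin N) (Fin N) ℝ) (x z y w : Fin N → ℝ) :
    tripleEquiv N (resid L x z y w) = primalMap N (x, z) - splitMap L (y, w) :=
  map_sub (tripleEquiv N) (x, z, x) (y, L.mulVec y, w)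

/-- The objective `(1/2)‖Ax − b‖² + μ‖z‖₁`. -/
noncomputable def objective (A : Matrix (Fin N) (Fin N) ℝ) (b : Fin N → ℝ) (μ : ℝ)
    (u : (Fin N → ℝ) × (Fin N → ℝ)) : ℝ :=
  1 / 2 * sqnorm (A.mulVec u.1 - b) + μ * l1norm u.2

theorem continuous_objective (A : Matrix (Fin N) (Fin N) ℝ) (b : Fin N → ℝ) (μ : ℝ) :
    Continuous (objective A b μ) := by
  unfold objective sqnorm l1norm
  simp only [Pi.sub_apply, Matrix.mulVec, dotProduct]
  fun_prop

theorem convexOn_sqnorm : ConvexOn ℝ Set.univ (sqnorm (N := N)) := by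
  refine ⟨convex_univ, fun x _ y _ s t hs ht hst => ?_⟩
  simp only [sqnorm, smul_eq_mul, Finset.mul_sum, ← Finset.sum_add_distrib]
  refine Finset.sum_le_sum fun i _ => ?_
  exact (even_two.convexOn_pow (𝕜 := ℝ)).2 (Set.mem_univ (x i)) (Set.mem_univ (y i)) hs ht hst

theorem convexOn_l1norm : ConvexOn ℝ Set.univ (l1norm (N := N)) := by
  refine ⟨convex_univ, fun x _ y _ s t hs ht hst => ?_⟩
  simp only [l1norm, smul_eq_mul, Finset.mul_sum, ← Finset.sum_add_distrib]
  refine Finset.sum_le_sum fun i _ => (abs_add_le _ _).trans ?_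
  simp [abs_mul, abs_of_nonneg hs, abs_of_nonneg ht]

theorem convexOn_objective (A : Matrix (Fin N) (Fin N) ℝ) (b : Fin N → ℝ) {μ : ℝ} (hμ : 0 ≤ μ) :
    ConvexOn ℝ Set.univ (objective A b μ) := by
  refine ⟨convex_univ, fun x _ y _ s t hs ht hst => ?_⟩
  have h1 := convexOn_sqnorm.2 (Set.mem_univ (A.mulVec x.1 - b)) (Set.mem_univ (A.mulVec y.1 - b))
    hs ht hst
  have h2 := convexOn_l1norm.2 (Set.mem_univ x.2) (Set.mem_univ y.2) hs ht hst
  have e : A.mulVec (s • x + t • y).1 - b = s • (A.mulVec x.1 - b) + t • (A.mulVec y.1 - b) := by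
    rw [Prod.fst_add, Prod.smul_fst, Prod.smul_fst, Matrix.mulVec_add, Matrix.mulVec_smul,
      Matrix.mulVec_smul]
    nth_rw 1 [← one_smul ℝ b, ← hst]
    module
  simp only [objective, smul_eq_mul] at h1 h2 ⊢
  rw [e]
  have h3 := mul_le_mul_of_nonneg_left h2 hμ
  simp only [Prod.snd_add, Prod.smul_snd]
  linarith

theorem lag0_of_nonneg (A L : Matrix (Fin N) (Fin N) ℝ) (b : Fin N → ℝ) (μ : ℝ)
    (x z y : Fin N → ℝ) {w : Fin N → ℝ} (hw : 0 ≤ w)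
    (l : (Fin N → ℝ) × (Fin N → ℝ) × (Fin N → ℝ)) :
    lag0 A L b μ x z y w l = ((objective A b μ (x, z) +
      inner ℝ (tripleEquiv N l) (primalMap N (x, z) - splitMap L (y, w)) : ℝ) : EReal) := by
  rw [lag0, iota0, if_pos hw, add_zero, ← tripleEquiv_resid, inner_tripleEquiv, objective]

theorem lag0_of_not_nonneg (A L : Matrix (Fin N) (Fin N) ℝ) (b : Fin N → ℝ) (μ : ℝ)
    (x z y : Fin N → ℝ) {w : Fin N → ℝ} (hw : ¬ 0 ≤ w)
    (l : (Fin N → ℝ) × (Fin N → ℝ) × (Fin N → ℝ)) :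
    lag0 A L b μ x z y w l = ⊤ := by
  rw [lag0, iota0, if_neg hw, EReal.coe_add_top]

theorem lagAug_of_nonneg (A L : Matrix (Fin N) (Fin N) ℝ) (b : Fin N → ℝ) (μ ρ : ℝ)
    (x z y : Fin N → ℝ) {w : Fin N → ℝ} (hw : 0 ≤ w)
    (l : (Fin N → ℝ) × (Fin N → ℝ) × (Fin N → ℝ)) :
    lagAug A L b μ ρ x z y w l = ((objective A b μ (x, z) +
      inner ℝ (tripleEquiv N l) (primalMap N (x, z) - splitMap L (y, w)) +
      ρ / 2 * ‖primalMap N (x, z) - splitMap L (y, w)‖ ^ 2 : ℝ) : EReal) := by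
  rw [lagAug, lag0_of_nonneg A L b μ x z y hw, ← tripleEquiv_resid, norm_sq_tripleEquiv,
    ← EReal.coe_add]

theorem lagAug_of_not_nonneg (A L : Matrix (Fin N) (Fin N) ℝ) (b : Fin N → ℝ) (μ ρ : ℝ)
    (x z y : Fin N → ℝ) {w : Fin N → ℝ} (hw : ¬ 0 ≤ w)
    (l : (Fin N → ℝ) × (Fin N → ℝ) × (Fin N → ℝ)) :
    lagAug A L b μ ρ x z y w l = ⊤ := by
  rw [lagAug, lag0_of_not_nonneg A L b μ x z y hw, EReal.top_add_coe]

/-- The pairs `(y, w)` with `w ≥ 0`. -/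
def sndNonneg (N : ℕ) : Set ((Fin N → ℝ) × (Fin N → ℝ)) := {p | 0 ≤ p.2}

theorem isClosed_sndNonneg : IsClosed (sndNonneg N) :=
  isClosed_Ici.preimage continuous_snd

theorem convex_sndNonneg : Convex ℝ (sndNonneg N) :=
  (convex_Ici (0 : Fin N → ℝ)).linear_preimage (LinearMap.snd ℝ _ _)

theorem isKKT_of_saddle {A L : Matrix (Fin N) (Fin N) ℝ} {b : Fin N → ℝ} {μ : ℝ}
    {x z y w : Fin N → ℝ} {l : (Fin N → ℝ) × (Fin N → ℝ) × (Fin N → ℝ)}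
    (h1 : ∀ l', lag0 A L b μ x z y w l' ≤ lag0 A L b μ x z y w l)
    (h2 : ∀ x' z' y' w', lag0 A L b μ x z y w l ≤ lag0 A L b μ x' z' y' w' l) :
    IsKKT (objective A b μ) (sndNonneg N) (primalMap N) (splitMap L) (x, z) (y, w)
      (tripleEquiv N l) := by
  have hw : 0 ≤ w := by
    by_contra hw
    have h := h2 0 0 0 0
    rw [lag0_of_not_nonneg A L b μ x z y hw, lag0_of_nonneg A L b μ 0 0 0 le_rfl] at h
    exact EReal.coe_ne_top _ (top_le_iff.1 h)
  have feas : primalMap N (x, z) - splitMap L (y, w) = 0 := by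
    have h := h1 (l + resid L x z y w)
    rw [lag0_of_nonneg A L b μ x z y hw, lag0_of_nonneg A L b μ x z y hw, EReal.coe_le_coe_iff,
      map_add, tripleEquiv_resid, inner_add_left, real_inner_self_eq_norm_sq] at h
    have h' : ‖primalMap N (x, z) - splitMap L (y, w)‖ ^ 2 ≤ 0 := by linarith
    exact norm_eq_zero.1 (pow_eq_zero_iff two_ne_zero |>.1 (le_antisymm h' (sq_nonneg _)))
  refine ⟨sub_eq_zero.1 feas, hw, fun u' => ?_, fun v' hv' => ?_⟩
  · have h := h2 u'.1 u'.2 y w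
    rw [lag0_of_nonneg A L b μ _ _ _ hw, lag0_of_nonneg A L b μ _ _ _ hw, EReal.coe_le_coe_iff,
      feas, inner_zero_right, add_zero] at h
    rwa [sub_eq_zero.1 feas]
  · have h := h2 x z v'.1 v'.2
    rw [lag0_of_nonneg A L b μ _ _ _ hw, lag0_of_nonneg A L b μ _ _ _ hv', EReal.coe_le_coe_iff,
      feas, inner_zero_right, sub_eq_zero.1 feas, ← neg_sub, inner_neg_right] at h
    linarith

theorem IsKKT.dualFn_le {A L : Matrix (Fin N) (Fin N) ℝ} {b : Fin N → ℝ} {μ : ℝ}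
    {u v : (Fin N → ℝ) × (Fin N → ℝ)} {l : (Fin N → ℝ) × (Fin N → ℝ) × (Fin N → ℝ)}
    (h : IsKKT (objective A b μ) (sndNonneg N) (primalMap N) (splitMap L) u v
      (tripleEquiv N l)) (l' : (Fin N → ℝ) × (Fin N → ℝ) × (Fin N → ℝ)) :
    dualFn A L b μ l' ≤ dualFn A L b μ l := by
  have hle : dualFn A L b μ l' ≤ lag0 A L b μ u.1 u.2 v.1 v.2 l' :=
    iInf_le_of_le u.1 (iInf_le_of_le u.2 (iInf_le_of_le v.1 (iInf_le _ v.2)))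
  refine hle.trans (le_iInf fun x => le_iInf fun z => le_iInf fun y => le_iInf fun w => ?_)
  by_cases hw : 0 ≤ w
  · rw [lag0_of_nonneg A L b μ _ _ _ h.mem, lag0_of_nonneg A L b μ _ _ _ hw,
      EReal.coe_le_coe_iff, Prod.mk.eta, Prod.mk.eta, h.feas, sub_self, inner_zero_right, add_zero]
    have h1 := h.primal (x, z)
    have h2 := h.normal (y, w) hw
    rw [h.feas] at h1
    rw [inner_sub_right] at h1 h2 ⊢
    linarith
  · rw [lag0_of_not_nonneg A L b μ _ _ _ hw]
    exact le_top

end Coordinates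

/-- ADMM: the multiplier sequence converges to a dual optimal point, i.e. a maximizer of the
dual function `d(λ) = inf_{x,z,y,w} L₀(x,z,y,w;λ)`, assuming `L₀` has a saddle point. -/
theorem admm_multiplier_convergence
    {N : ℕ} (A L : Matrix (Fin N) (Fin N) ℝ) (b : Fin N → ℝ) (μ ρ : ℝ)
    (hμ : 0 < μ) (hρ : 0 < ρ)
    (hsaddle : ∃ (xs zs ys ws : Fin N → ℝ)
        (ls : (Fin N → ℝ) × (Fin N → ℝ) × (Fin N → ℝ)),
      (∀ lam, lag0 A L b μ xs zs ys ws lam ≤ lag0 A L b μ xs zs ys ws ls) ∧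
      (∀ x z y w, lag0 A L b μ xs zs ys ws ls ≤ lag0 A L b μ x z y w ls))
    (X Z Y W : ℕ → (Fin N → ℝ))
    (Λ : ℕ → (Fin N → ℝ) × (Fin N → ℝ) × (Fin N → ℝ))
    (hxz : ∀ k, ∀ x z : Fin N → ℝ,
      lagAug A L b μ ρ (X (k + 1)) (Z (k + 1)) (Y k) (W k) (Λ k) ≤
        lagAug A L b μ ρ x z (Y k) (W k) (Λ k))
    (hyw : ∀ k, ∀ y w : Fin N → ℝ,
      lagAug A L b μ ρ (X (k + 1)) (Z (k + 1)) (Y (k + 1)) (W (k + 1)) (Λ k) ≤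
        lagAug A L b μ ρ (X (k + 1)) (Z (k + 1)) y w (Λ k))
    (hΛ : ∀ k, Λ (k + 1) =
      Λ k + ρ • resid L (X (k + 1)) (Z (k + 1)) (Y (k + 1)) (W (k + 1))) :
    ∃ lamInf : (Fin N → ℝ) × (Fin N → ℝ) × (Fin N → ℝ),
      Tendsto Λ atTop (𝓝 lamInf) ∧
      ∀ lam, dualFn A L b μ lam ≤ dualFn A L b μ lamInf := by
  obtain ⟨xs, zs, ys, ws, ls, hs1, hs2⟩ := hsaddle
  have h₀ := isKKT_of_saddle hs1 hs2
  have hW k : 0 ≤ W (k + 1) := by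
    by_contra hw
    have h := hyw k 0 0
    rw [lagAug_of_not_nonneg A L b μ ρ _ _ _ hw, lagAug_of_nonneg A L b μ ρ _ _ _ le_rfl] at h
    exact EReal.coe_ne_top _ (top_le_iff.1 h)
  have hup k : tripleEquiv N (Λ (k + 1)) = tripleEquiv N (Λ k) +
      ρ • (primalMap N (X (k + 1), Z (k + 1)) - splitMap L (Y (k + 1), W (k + 1))) := by
    rw [hΛ, map_add, map_smul, tripleEquiv_resid]
  have hadmm : IsADMM (objective A b μ) (sndNonneg N) (primalMap N) (splitMap L) ρ
      (fun k => (X (k + 1), Z (k + 1))) (fun k => (Y (k + 1), W (k + 1)))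
      (fun k => tripleEquiv N (Λ (k + 1))) := by
    refine ⟨hW, fun k v hv => ?_, fun k u => ?_, fun k => hup _⟩
    · have h := (convexOn_const (𝕜 := ℝ) (0 : ℝ) (convex_sndNonneg (N := N))
        ).variational_of_forall_le (-splitMap L) (-primalMap N (X (k + 1), Z (k + 1)))
        (tripleEquiv N (Λ k)) ρ (u₀ := (Y (k + 1), W (k + 1))) (hW k) (fun v hv => ?_) hv
      · have e : -splitMap L (Y (k + 1), W (k + 1)) - -primalMap N (X (k + 1), Z (k + 1)) =
          primalMap N (X (k + 1), Z (k + 1)) - splitMap L (Y (k + 1), W (k + 1)) := by abel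
        rw [LinearMap.neg_apply, LinearMap.neg_apply, e, ← hup, ← neg_sub', inner_neg_right] at h
        linarith
      · have h := hyw k v.1 v.2
        rw [lagAug_of_nonneg A L b μ ρ _ _ _ (hW k), lagAug_of_nonneg A L b μ ρ _ _ _ hv,
          EReal.coe_le_coe_iff] at h
        simp only [LinearMap.neg_apply, neg_sub_neg]
        linarith
    · refine (convexOn_objective A b hμ.le).variational_of_forall_le (primalMap N)
        (splitMap L (Y (k + 1), W (k + 1))) (tripleEquiv N (Λ (k + 1))) ρ (Set.mem_univ _)
        (fun u _ => ?_) (Set.mem_univ u)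
      have h := hxz (k + 1) u.1 u.2
      rwa [lagAug_of_nonneg A L b μ ρ _ _ _ (hW k), lagAug_of_nonneg A L b μ ρ _ _ _ (hW k),
        EReal.coe_le_coe_iff] at h
  obtain ⟨u, v, l, hl, hK⟩ := hadmm.exists_tendsto_isKKT h₀ hρ primalMap_injective
    (splitMap_injective L) (continuous_objective A b μ) isClosed_sndNonneg
  refine ⟨(tripleEquiv N).symm l, ?_, IsKKT.dualFn_le (u := u) (v := v) (by simpa using hK)⟩
  rw [← tendsto_add_atTop_iff_nat 1]
  simpa [Function.comp_def] using ((tripleEquiv N).symm.continuous.tendsto l).comp hl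
end

section
/- Let F ∈ ℂ^{N×N} be unitary, let Σ, Λ_x, Λ_y ∈ ℂ^{N×N} be diagonal matrices, set A = F*ΣF and L = [F*Λ_xF ; F*Λ_yF] ∈ ℂ^{2N×N}, let μ > 0, and suppose Σ*Σ + μ(Λ_x*Λ_x + Λ_y*Λ_y) is invertible. Then trace(I − A(A*A + μL*L)⁻¹A*) = trace(I − ΣΣ*(Σ*Σ + μ(Λ_x*Λ_x + Λ_y*Λ_y))⁻¹). -/
open Matrix

/-- `A = F*ΣF`. -/
noncomputable def Amat {N : ℕ} (F S : Matrix (Fin N) (Fin N) ℂ) : Matrix (Fin N) (Fin N) ℂ :=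
  Fᴴ * S * F

/-- The stacked matrix `L = [F*Λ_xF ; F*Λ_yF] ∈ ℂ^{2N×N}`. -/
noncomputable def Lmat {N : ℕ} (F Lx Ly : Matrix (Fin N) (Fin N) ℂ) :
    Matrix (Fin N ⊕ Fin N) (Fin N) ℂ :=
  Matrix.fromRows (Fᴴ * Lx * F) (Fᴴ * Ly * F)

/-- The diagonal matrix `Σ*Σ + μ(Λ_x*Λ_x + Λ_y*Λ_y)`. -/
noncomputable def Dmat {N : ℕ} (S Lx Ly : Matrix (Fin N) (Fin N) ℂ) (μ : ℝ) :
    Matrix (Fin N) (Fin N) ℂ :=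
  Sᴴ * S + (μ : ℂ) • (Lxᴴ * Lx + Lyᴴ * Ly)

/-- Conjugation by a matrix `F` with `F * Fᴴ = 1` is multiplicative. -/
lemma conjTranspose_conj_mul {m n : Type*} [Fintype m] [Fintype n] [DecidableEq m]
    {F : Matrix m n ℂ} (hF : F * Fᴴ = 1) (X Y : Matrix m m ℂ) :
    (Fᴴ * X * F) * (Fᴴ * Y * F) = Fᴴ * (X * Y) * F := by
  calc (Fᴴ * X * F) * (Fᴴ * Y * F) = Fᴴ * X * (F * Fᴴ) * Y * F := by
        simp only [Matrix.mul_assoc]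
    _ = Fᴴ * (X * Y) * F := by rw [hF, Matrix.mul_one, Matrix.mul_assoc Fᴴ X Y]

/-- The conjugate transpose of a conjugated matrix. -/
lemma conjTranspose_conj {m n : Type*} [Fintype m] (F : Matrix m n ℂ) (X : Matrix m m ℂ) :
    (Fᴴ * X * F)ᴴ = Fᴴ * Xᴴ * F := by
  simp [Matrix.mul_assoc]

/-- The regularized normal matrix is the conjugate of `Dmat` by `F`. -/
lemma normal_matrix_eq_conj_Dmat {N : ℕ} {F : Matrix (Fin N) (Fin N) ℂ} (hF : F * Fᴴ = 1)
    (S Lx Ly : Matrix (Fin N) (Fin N) ℂ) (μ : ℝ) :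
    (Amat F S)ᴴ * Amat F S + (μ : ℂ) • ((Lmat F Lx Ly)ᴴ * Lmat F Lx Ly)
      = Fᴴ * Dmat S Lx Ly μ * F := by
  simp only [Amat, Lmat, Dmat, conjTranspose_fromRows_eq_fromCols_conjTranspose,
    fromCols_mul_fromRows, conjTranspose_conj, conjTranspose_conj_mul hF, Matrix.mul_add,
    Matrix.add_mul, Matrix.mul_smul, Matrix.smul_mul]

/-- A diagonal matrix commutes with its conjugate transpose. -/
lemma Matrix.IsDiag.mul_conjTranspose_comm {n : Type*} [Fintype n] [DecidableEq n]
    {S : Matrix n n ℂ} (hS : S.IsDiag) : S * Sᴴ = Sᴴ * S := by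
  rw [← hS.diagonal_diag, diagonal_conjTranspose, diagonal_mul_diagonal, diagonal_mul_diagonal]
  simp only [mul_comm]

/-- For `F` unitary, `Σ, Λ_x, Λ_y` diagonal, `A = F*ΣF`, `L = [F*Λ_xF ; F*Λ_yF]`, `μ > 0` and
`Σ*Σ + μ(Λ_x*Λ_x + Λ_y*Λ_y)` invertible,
`trace(I − A(A*A + μL*L)⁻¹A*) = trace(I − ΣΣ*(Σ*Σ + μ(Λ_x*Λ_x + Λ_y*Λ_y))⁻¹)`. -/
theorem spectral_tikhonov_trace_formula {N : ℕ}
    (F S Lx Ly : Matrix (Fin N) (Fin N) ℂ)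
    (hF1 : Fᴴ * F = 1) (hF2 : F * Fᴴ = 1)
    (hS : S.IsDiag) (hLx : Lx.IsDiag) (hLy : Ly.IsDiag)
    (μ : ℝ) (hμ : 0 < μ)
    (hinv : IsUnit (Dmat S Lx Ly μ)) :
    Matrix.trace (1 - Amat F S * ((Amat F S)ᴴ * Amat F S
        + (μ : ℂ) • ((Lmat F Lx Ly)ᴴ * Lmat F Lx Ly))⁻¹ * (Amat F S)ᴴ)
      = Matrix.trace (1 - S * Sᴴ * (Dmat S Lx Ly μ)⁻¹) := by
  have hFinv : F⁻¹ = Fᴴ := inv_eq_right_inv hF2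
  have hFHinv : Fᴴ⁻¹ = F := inv_eq_right_inv hF1
  rw [normal_matrix_eq_conj_Dmat hF2, Matrix.mul_inv_rev, Matrix.mul_inv_rev, hFinv, hFHinv,
    ← Matrix.mul_assoc Fᴴ, Amat, conjTranspose_conj, conjTranspose_conj_mul hF2,
    conjTranspose_conj_mul hF2, trace_sub, trace_sub, trace_mul_cycle, hF2, Matrix.one_mul,
    trace_mul_cycle, hS.mul_conjTranspose_comm]
end
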